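/- Fix s > 0. For all t > 0 and all distinct x, y ∈ ℝ⁺, the fractional dyadic diffusion metric satisfies d_t(x,y) = ψ_t(δ(x,y)); explicitly, d_t(x,y)² = (2/δ(x,y)) [ 2 e^{−2t δ(x,y)^{−s}} + Σ_{ℓ ≥ 1} 2^{ℓ} e^{−2t δ(x,y)^{−s} 2^{ℓ s}} ] = ψ_t(δ(x,y))², and d_t(x,x) = 0 = ψ_t(0). -/

import Mathlib

open Real Set

/-- The dyadic interval `I^j_k = [k 2^{-j}, (k+1) 2^{-j}) ⊂ ℝ⁺`, `j ∈ ℤ`, `k ∈ ℕ₀`. -/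
def dyadicI (j : ℤ) (k : ℕ) : Set ℝ :=
  Set.Ico ((k : ℝ) * (2 : ℝ) ^ (-j)) (((k : ℝ) + 1) * (2 : ℝ) ^ (-j))

/-- The dyadic distance `δ(x,y) = inf {|I| : I dyadic interval containing x and y}`. -/
noncomputable def dyadicDist (x y : ℝ) : ℝ :=
  if x = y then 0
  else sInf {l : ℝ | ∃ (j : ℤ) (k : ℕ), l = (2 : ℝ) ^ (-j) ∧ x ∈ dyadicI j k ∧ y ∈ dyadicI j k}

/-- The mother Haar wavelet `h = χ_{[0,1/2)} - χ_{[1/2,1)}`. -/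
noncomputable def motherHaar (x : ℝ) : ℝ :=
  if 0 ≤ x ∧ x < 1 / 2 then 1 else if 1 / 2 ≤ x ∧ x < 1 then -1 else 0

/-- The Haar wavelet `h^j_k(x) = 2^{j/2} h(2^j x - k)`, supported on `I^j_k`. -/
noncomputable def haarFn (j : ℤ) (k : ℕ) (x : ℝ) : ℝ :=
  (2 : ℝ) ^ ((j : ℝ) / 2) * motherHaar ((2 : ℝ) ^ j * x - (k : ℝ))

/-- The fractional dyadic diffusion distance
`d_t(x,y) = (Σ_h e^{-2t|I(h)|^{-s}} |h(x) - h(y)|²)^{1/2}`. -/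
noncomputable def dyadicDt (s t x y : ℝ) : ℝ :=
  Real.sqrt (∑' p : ℤ × ℕ,
    Real.exp (-2 * t * ((2 : ℝ) ^ (-p.1)) ^ (-s)) * (haarFn p.1 p.2 x - haarFn p.1 p.2 y) ^ 2)

/-- `η_t(σ) = 2 e^{-2tσ} + Σ_{ℓ≥1} 2^ℓ e^{-2t 2^{sℓ} σ}`. -/
noncomputable def etaFn (s t σ : ℝ) : ℝ :=
  2 * Real.exp (-2 * t * σ) +
    ∑' l : ℕ, (2 : ℝ) ^ (l + 1) * Real.exp (-2 * t * (2 : ℝ) ^ (s * ((l : ℝ) + 1)) * σ)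

/-- `ψ_t(λ) = √((2/λ) η_t(λ^{-s}))` (with `ψ_t(0) = 0`). -/
noncomputable def psiFn (s t lam : ℝ) : ℝ :=
  Real.sqrt ((2 / lam) * etaFn s t (lam ^ (-s)))

/-- The index `k` of the dyadic interval of level `j` that contains `x ≥ 0`. -/
noncomputable def dyadicIndex (j : ℤ) (x : ℝ) : ℕ := ⌊(2 : ℝ) ^ j * x⌋₊

lemma mem_dyadicI_iff {x : ℝ} (hx : 0 ≤ x) (j : ℤ) (k : ℕ) :
    x ∈ dyadicI j k ↔ dyadicIndex j x = k := by
  have h2 : (0 : ℝ) < 2 ^ j := by positivity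
  rw [dyadicIndex, Nat.floor_eq_iff (by positivity), dyadicI, Set.mem_Ico, zpow_neg,
    ← div_eq_mul_inv, ← div_eq_mul_inv, div_le_iff₀ h2, lt_div_iff₀ h2, mul_comm x]

lemma dyadicIndex_succ_div_two (j : ℤ) (x : ℝ) :
    dyadicIndex (j + 1) x / 2 = dyadicIndex j x := by
  rw [dyadicIndex, dyadicIndex, ← Nat.floor_div_ofNat, zpow_add_one₀ two_ne_zero]
  congr 1
  ring

lemma motherHaar_sub_natCast {u : ℝ} (hu : 0 ≤ u) (k : ℕ) :
    motherHaar (u - k) =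
      if ⌊2 * u⌋₊ = 2 * k then 1 else if ⌊2 * u⌋₊ = 2 * k + 1 then -1 else 0 := by
  have h0 : 0 ≤ 2 * u := by positivity
  simp only [motherHaar, Nat.floor_eq_iff h0]
  push_cast
  congr 1
  · exact propext ⟨fun h => ⟨by linarith, by linarith⟩, fun h => ⟨by linarith, by linarith⟩⟩
  · congr 1
    exact propext ⟨fun h => ⟨by linarith, by linarith⟩, fun h => ⟨by linarith, by linarith⟩⟩

lemma haarFn_eq {x : ℝ} (hx : 0 ≤ x) (j : ℤ) (k : ℕ) :
    haarFn j k x = (2 : ℝ) ^ ((j : ℝ) / 2) *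
      if dyadicIndex (j + 1) x = 2 * k then 1
      else if dyadicIndex (j + 1) x = 2 * k + 1 then -1 else 0 := by
  rw [haarFn, motherHaar_sub_natCast (by positivity), dyadicIndex, zpow_add_one₀ two_ne_zero,
    mul_comm ((2 : ℝ) ^ j) 2, mul_assoc]

lemma sq_haarFn_sub {x y : ℝ} (hx : 0 ≤ x) (hy : 0 ≤ y) (j : ℤ) (k : ℕ) :
    (haarFn j k x - haarFn j k y) ^ 2 = (2 : ℝ) ^ j *
      ((if dyadicIndex (j + 1) x = 2 * k then 1
        else if dyadicIndex (j + 1) x = 2 * k + 1 then -1 else 0) -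
      (if dyadicIndex (j + 1) y = 2 * k then 1
        else if dyadicIndex (j + 1) y = 2 * k + 1 then -1 else 0)) ^ 2 := by
  rw [haarFn_eq hx, haarFn_eq hy, ← mul_sub, mul_pow, ← Real.rpow_natCast, ← Real.rpow_mul two_pos.le]
  norm_num

lemma sq_haarFn_sub_of_index_succ_eq {x y : ℝ} (hx : 0 ≤ x) (hy : 0 ≤ y) {j : ℤ}
    (h : dyadicIndex (j + 1) x = dyadicIndex (j + 1) y) (k : ℕ) :
    (haarFn j k x - haarFn j k y) ^ 2 = 0 := by
  rw [sq_haarFn_sub hx hy, h]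
  simp

lemma sq_haarFn_sub_of_ne_index {x y : ℝ} (hx : 0 ≤ x) (hy : 0 ≤ y) {j : ℤ} {k : ℕ}
    (hkx : k ≠ dyadicIndex j x) (hky : k ≠ dyadicIndex j y) :
    (haarFn j k x - haarFn j k y) ^ 2 = 0 := by
  have h1 := dyadicIndex_succ_div_two j x
  have h2 := dyadicIndex_succ_div_two j y
  rw [sq_haarFn_sub hx hy, if_neg (by omega), if_neg (by omega), if_neg (by omega),
    if_neg (by omega)]
  simp

lemma sq_haarFn_sub_of_split {x y : ℝ} (hx : 0 ≤ x) (hy : 0 ≤ y) {j : ℤ}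
    (h : dyadicIndex j x = dyadicIndex j y)
    (h' : dyadicIndex (j + 1) x ≠ dyadicIndex (j + 1) y) :
    (haarFn j (dyadicIndex j x) x - haarFn j (dyadicIndex j x) y) ^ 2 = 4 * (2 : ℝ) ^ j := by
  have h1 := dyadicIndex_succ_div_two j x
  have h2 := dyadicIndex_succ_div_two j y
  rw [sq_haarFn_sub hx hy]
  split_ifs <;> first | omega | ring

lemma sq_haarFn_sub_of_index_ne {x y : ℝ} (hx : 0 ≤ x) (hy : 0 ≤ y) {j : ℤ}
    (h : dyadicIndex j x ≠ dyadicIndex j y) :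
    (haarFn j (dyadicIndex j x) x - haarFn j (dyadicIndex j x) y) ^ 2 = (2 : ℝ) ^ j := by
  have h1 := dyadicIndex_succ_div_two j x
  have h2 := dyadicIndex_succ_div_two j y
  rw [sq_haarFn_sub hx hy]
  split_ifs <;> first | omega | ring

lemma dyadicIndex_eq_of_le {x y : ℝ} {i j : ℤ} (hij : i ≤ j)
    (h : dyadicIndex j x = dyadicIndex j y) : dyadicIndex i x = dyadicIndex i y := by
  induction i, hij using Int.leInductionDown with
  | base => exact h
  | pred n _ ih =>
    have hx := dyadicIndex_succ_div_two (n - 1) x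
    have hy := dyadicIndex_succ_div_two (n - 1) y
    rw [sub_add_cancel] at hx hy
    rw [← hx, ← hy, ih]

lemma exists_splitting_level {x y : ℝ} (hx : 0 ≤ x) (hy : 0 ≤ y) (hxy : x ≠ y) :
    ∃ J : ℤ, ∀ j, dyadicIndex j x = dyadicIndex j y ↔ j ≤ J := by
  have hd : 0 < |x - y| := abs_pos.2 (sub_ne_zero.2 hxy)
  obtain ⟨b, hb⟩ := pow_unbounded_of_one_lt (|x - y|⁻¹) (one_lt_two (α := ℝ))
  obtain ⟨n, hn⟩ := pow_unbounded_of_one_lt (max x y) (one_lt_two (α := ℝ))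
  have zero_of_lt : ∀ z : ℝ, z < 2 ^ n → dyadicIndex (-(n : ℤ)) z = 0 := fun z hz => by
    rw [dyadicIndex, Nat.floor_eq_zero, zpow_neg, zpow_natCast, inv_mul_lt_iff₀ (by positivity)]
    simpa using hz
  obtain ⟨J, hJ, hmax⟩ := Int.exists_greatest_of_bdd
    (P := fun j => dyadicIndex j x = dyadicIndex j y)
    ⟨b, fun j hj => by
      by_contra! hlt
      have h := dyadicIndex_eq_of_le hlt.le hj
      simp only [dyadicIndex, zpow_natCast] at h
      have hx1 := Nat.floor_le (show 0 ≤ (2 : ℝ) ^ b * x by positivity)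
      have hx2 := Nat.lt_floor_add_one ((2 : ℝ) ^ b * x)
      have hy1 := Nat.floor_le (show 0 ≤ (2 : ℝ) ^ b * y by positivity)
      have hy2 := Nat.lt_floor_add_one ((2 : ℝ) ^ b * y)
      rw [h] at hx1 hx2
      have habs : |(2 : ℝ) ^ b * (x - y)| < 1 := abs_lt.2 ⟨by linarith, by linarith⟩
      rw [abs_mul, abs_of_pos (by positivity : (0 : ℝ) < 2 ^ b)] at habs
      have := (inv_lt_iff_one_lt_mul₀ hd).1 hb
      linarith⟩
    ⟨-(n : ℤ), by
      rw [zero_of_lt x ((le_max_left _ _).trans_lt hn),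
        zero_of_lt y ((le_max_right _ _).trans_lt hn)]⟩
  exact ⟨J, fun j => ⟨hmax j, fun h => dyadicIndex_eq_of_le h hJ⟩⟩

lemma dyadicDist_eq_of_splitting_level {x y : ℝ} (hx : 0 ≤ x) (hy : 0 ≤ y) (hxy : x ≠ y) {J : ℤ}
    (hJ : ∀ j, dyadicIndex j x = dyadicIndex j y ↔ j ≤ J) : dyadicDist x y = (2 : ℝ) ^ (-J) := by
  rw [dyadicDist, if_neg hxy]
  refine IsLeast.csInf_eq ⟨⟨J, dyadicIndex J x, rfl, ?_, ?_⟩, ?_⟩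
  · rw [mem_dyadicI_iff hx]
  · rw [mem_dyadicI_iff hy, (hJ J).2 le_rfl]
  · rintro _ ⟨j, k, rfl, h1, h2⟩
    rw [mem_dyadicI_iff hx] at h1
    rw [mem_dyadicI_iff hy] at h2
    have := (hJ j).1 (h1.trans h2.symm)
    exact zpow_le_zpow_right₀ one_le_two (by omega)

lemma summable_two_pow_mul_exp_neg {s c : ℝ} (hs : 0 < s) (hc : 0 < c) :
    Summable fun l : ℕ => (2 : ℝ) ^ (l + 1) * Real.exp (-c * (2 : ℝ) ^ (((l : ℝ) + 1) * s)) := by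
  have hr : (1 : ℝ) < 2 ^ s := Real.one_lt_rpow one_lt_two hs
  have hpow : ∀ l : ℕ, (2 : ℝ) ^ (((l : ℝ) + 1) * s) = (2 ^ s) ^ (l + 1) := fun l => by
    rw [mul_comm, Real.rpow_mul two_pos.le, ← Real.rpow_natCast]
    push_cast
    rfl
  simp only [hpow]
  refine summable_of_ratio_test_tendsto_lt_one (l := 0) one_pos
    (Filter.Eventually.of_forall fun l => by positivity) ?_
  have hlim : Filter.Tendsto
      (fun l : ℕ => 2 * Real.exp (-(c * (2 ^ s - 1) * ((2 : ℝ) ^ s) ^ (l + 1))))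
      Filter.atTop (nhds (2 * 0)) := by
    refine (Real.tendsto_exp_neg_atTop_nhds_zero.comp ?_).const_mul 2
    exact ((tendsto_pow_atTop_atTop_of_one_lt hr).comp (Filter.tendsto_add_atTop_nat 1)).const_mul_atTop
      (mul_pos hc (sub_pos.2 hr))
  rw [mul_zero] at hlim
  refine hlim.congr fun l => ?_
  rw [Real.norm_of_nonneg (by positivity), Real.norm_of_nonneg (by positivity),
    eq_div_iff (by positivity)]
  have hexp : Real.exp (-c * ((2 : ℝ) ^ s) ^ (l + 1 + 1)) =
      Real.exp (-(c * (2 ^ s - 1) * ((2 : ℝ) ^ s) ^ (l + 1))) *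
        Real.exp (-c * ((2 : ℝ) ^ s) ^ (l + 1)) := by
    rw [← Real.exp_add]
    congr 1
    ring
  rw [hexp]
  ring

/-- Contribution of one dyadic interval of level `J + l + 1` to the squared metric. -/
lemma exp_mul_zpow_add (s t : ℝ) (J : ℤ) (l : ℕ) :
    Real.exp (-2 * t * ((2 : ℝ) ^ (-(J + (l + 1 : ℕ)))) ^ (-s)) * (2 : ℝ) ^ (J + (l + 1 : ℕ)) =
      (1 / (2 : ℝ) ^ (-J)) * ((2 : ℝ) ^ (l + 1) *
        Real.exp (-2 * t * ((2 : ℝ) ^ (-J)) ^ (-s) * (2 : ℝ) ^ (((l : ℝ) + 1) * s))) := by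
  have h1 : ((2 : ℝ) ^ (-(J + (l + 1 : ℕ)))) ^ (-s) =
      ((2 : ℝ) ^ (-J)) ^ (-s) * (2 : ℝ) ^ (((l : ℝ) + 1) * s) := by
    rw [← Real.rpow_intCast, ← Real.rpow_intCast, ← Real.rpow_mul two_pos.le,
      ← Real.rpow_mul two_pos.le, ← Real.rpow_add two_pos]
    congr 1
    push_cast
    ring
  rw [h1, zpow_add₀ two_ne_zero, zpow_natCast, zpow_neg, one_div, inv_inv]
  ring_nf

lemma hasSum_dyadicDt {s t x y : ℝ} (hs : 0 < s) (ht : 0 < t) (hx : 0 ≤ x) (hy : 0 ≤ y)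
    (hxy : x ≠ y) :
    HasSum (fun p : ℤ × ℕ => Real.exp (-2 * t * ((2 : ℝ) ^ (-p.1)) ^ (-s)) *
        (haarFn p.1 p.2 x - haarFn p.1 p.2 y) ^ 2)
      ((2 / dyadicDist x y) *
        (2 * Real.exp (-2 * t * dyadicDist x y ^ (-s)) +
          ∑' l : ℕ, (2 : ℝ) ^ (l + 1) *
            Real.exp (-2 * t * dyadicDist x y ^ (-s) * (2 : ℝ) ^ (((l : ℝ) + 1) * s)))) := by
  obtain ⟨J, hJ⟩ := exists_splitting_level hx hy hxy
  rw [dyadicDist_eq_of_splitting_level hx hy hxy hJ]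
  have hsum := (summable_two_pow_mul_exp_neg hs
    (show 0 < 2 * t * ((2 : ℝ) ^ (-J)) ^ (-s) by positivity)).hasSum
  simp only [← neg_mul] at hsum
  have hne : ∀ l : ℕ, dyadicIndex (J + (l + 1 : ℕ)) x ≠ dyadicIndex (J + (l + 1 : ℕ)) y :=
    fun l h => by have := (hJ _).1 h; omega
  let e : (ℕ ⊕ ℕ) ⊕ Unit → ℤ × ℕ := Sum.elim
    (Sum.elim (fun l => (J + (l + 1 : ℕ), dyadicIndex (J + (l + 1 : ℕ)) x))
      (fun l => (J + (l + 1 : ℕ), dyadicIndex (J + (l + 1 : ℕ)) y)))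
    (fun _ => (J, dyadicIndex J x))
  have he : Function.Injective e := by
    rintro ((a | a) | a) ((b | b) | b) hab <;>
      simp only [e, Sum.elim_inl, Sum.elim_inr, Prod.mk.injEq] at hab
    · obtain rfl : a = b := by omega
      rfl
    · obtain rfl : a = b := by omega
      exact absurd hab.2 (hne a)
    · omega
    · obtain rfl : a = b := by omega
      exact absurd hab.2.symm (hne a)
    · obtain rfl : a = b := by omega
      rfl
    · omega
    · omega
    · omega
    · rfl
  rw [← he.hasSum_iff]
  · have hS := hsum.mul_left (1 / (2 : ℝ) ^ (-J))
    have hU := hasSum_unique (fun _ : Unit =>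
      Real.exp (-2 * t * ((2 : ℝ) ^ (-J)) ^ (-s)) * (4 * (2 : ℝ) ^ J))
    have key := HasSum.sum (f := (fun p : ℤ × ℕ => Real.exp (-2 * t * ((2 : ℝ) ^ (-p.1)) ^ (-s)) *
        (haarFn p.1 p.2 x - haarFn p.1 p.2 y) ^ 2) ∘ e)
      (HasSum.sum (hS.congr_fun ?_) (hS.congr_fun ?_)) (hU.congr_fun ?_)
    · convert! key using 1
      rw [zpow_neg]
      field_simp
      ring
    · intro l
      simp only [Function.comp_apply, e, Sum.elim_inl]
      rw [sq_haarFn_sub_of_index_ne hx hy (hne l), exp_mul_zpow_add]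
    · intro l
      simp only [Function.comp_apply, e, Sum.elim_inl, Sum.elim_inr]
      rw [sub_sq_comm, sq_haarFn_sub_of_index_ne hy hx (hne l).symm, exp_mul_zpow_add]
    · intro _
      simp only [Function.comp_apply, e, Sum.elim_inr]
      rw [sq_haarFn_sub_of_split hx hy ((hJ J).2 le_rfl)
        (fun h => by have := (hJ _).1 h; omega)]
  · rintro ⟨j, k⟩ hjk
    simp only [mul_eq_zero]
    right
    rcases lt_trichotomy j J with h | rfl | h
    · exact sq_haarFn_sub_of_index_succ_eq hx hy ((hJ _).2 h) k
    · have hk : k ≠ dyadicIndex j x := fun h => hjk ⟨Sum.inr (), by simp [e, h]⟩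
      exact sq_haarFn_sub_of_ne_index hx hy hk ((hJ j).2 le_rfl ▸ hk)
    · obtain ⟨l, rfl⟩ : ∃ l : ℕ, j = J + (l + 1 : ℕ) := ⟨(j - J - 1).toNat, by omega⟩
      exact sq_haarFn_sub_of_ne_index hx hy
        (fun h => hjk ⟨Sum.inl (Sum.inl l), by simp [e, h]⟩)
        (fun h => hjk ⟨Sum.inl (Sum.inr l), by simp [e, h]⟩)

/-- The fractional dyadic diffusion metric is a function of the dyadic distance:
`d_t(x,y) = ψ_t(δ(x,y))`, with the explicit formula
`d_t(x,y)² = (2/δ(x,y)) [2 e^{-2t δ^{-s}} + Σ_{ℓ≥1} 2^ℓ e^{-2t δ^{-s} 2^{ℓs}}]`,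
and `d_t(x,x) = 0 = ψ_t(0)`. -/
theorem dyadicDt_eq_psi_of_dyadicDist (s : ℝ) (hs : 0 < s) (t : ℝ) (ht : 0 < t) :
    (∀ x ∈ Set.Ici (0 : ℝ), ∀ y ∈ Set.Ici (0 : ℝ), x ≠ y →
      dyadicDt s t x y ^ 2 = (2 / dyadicDist x y) *
        (2 * Real.exp (-2 * t * dyadicDist x y ^ (-s)) +
          ∑' l : ℕ, (2 : ℝ) ^ (l + 1) *
            Real.exp (-2 * t * dyadicDist x y ^ (-s) * (2 : ℝ) ^ (((l : ℝ) + 1) * s))) ∧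
      dyadicDt s t x y = psiFn s t (dyadicDist x y)) ∧
    (∀ x : ℝ, dyadicDt s t x x = 0) ∧
    psiFn s t 0 = 0 := by
  refine ⟨fun x hx y hy hxy => ?_, fun x => by simp [dyadicDt], by simp [psiFn]⟩
  have h := hasSum_dyadicDt hs ht hx hy hxy
  have hsq := h.tsum_eq
  refine ⟨?_, ?_⟩
  · rw [dyadicDt, Real.sq_sqrt (tsum_nonneg fun p => by positivity), hsq]
  · rw [dyadicDt, psiFn, etaFn, hsq]
    congr 5
    funext l
    ring_nf
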